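/- Let (X_1,…,X_n) be an H-frame on an open neighborhood U of 0 in ℝⁿ with X_j(0) = e_j for all j (linearly adapted coordinates). Then the following are equivalent: (i) each coordinate function x ↦ x_k has order w_k at 0 (the coordinates are privileged at 0); (ii) for each j there is a vector field X_j^{(0)} on ℝⁿ, homogeneous of degree −w_j, such that t^{w_j} δ_t^*X_j = X_j^{(0)} + O(t) in C^∞(U) as t → 0; (iii) for each j, the vector field X_j has weight −w_j; (iv) for every multi-index α with |α| ≥ 1, writing X^α = Σ_{β : 1 ≤ |β| ≤ |α|} a_{αβ}(x) ∂^β (the unique such representation with smooth coefficients a_{αβ}), every coefficient a_{αβ} has weight ≥ ⟨β⟩ − ⟨α⟩, and at least one coefficient a_{αβ} has weight exactly ⟨β⟩ − ⟨α⟩. -/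

import Mathlib

open scoped BigOperators
open Filter Topology

namespace Carnot

/-- Anisotropic dilation `t · x = (t^{w_1} x_1, …, t^{w_n} x_n)`. -/
def dil {n : ℕ} (w : Fin n → ℕ) (t : ℝ) (x : Fin n → ℝ) : Fin n → ℝ :=
  fun i => t ^ (w i) * x i

/-- Weighted length `⟨α⟩` of a multi-index. -/
def wlen {n : ℕ} (w : Fin n → ℕ) (α : Fin n → ℕ) : ℕ := ∑ i, w i * α i

/-- Length `|α|` of a multi-index. -/
def mlen {n : ℕ} (α : Fin n → ℕ) : ℕ := ∑ i, α i

/-- A vector field acting on a function: `(Xf)(x) = Df(x)[X(x)]`. -/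
noncomputable def vf {n : ℕ} (X : (Fin n → ℝ) → (Fin n → ℝ)) (f : (Fin n → ℝ) → ℝ) :
    (Fin n → ℝ) → ℝ :=
  fun x => fderiv ℝ f x (X x)

/-- Iterated action `X_I f = X_{i_1}(X_{i_2}(⋯(X_{i_k} f)))`. -/
noncomputable def vfSeq {n : ℕ} (X : Fin n → (Fin n → ℝ) → (Fin n → ℝ)) :
    List (Fin n) → ((Fin n → ℝ) → ℝ) → ((Fin n → ℝ) → ℝ)
  | [], f => f
  | i :: I, f => vf (X i) (vfSeq X I f)

/-- Weight `⟨I⟩` of a finite sequence of indices. -/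
def seqW {n : ℕ} (w : Fin n → ℕ) (I : List (Fin n)) : ℕ := (I.map w).sum

/-- The list `(1,…,1,2,…,2,…,n,…,n)` with `i` repeated `α i` times. -/
def multiList {n : ℕ} (α : Fin n → ℕ) : List (Fin n) :=
  (List.finRange n).flatMap fun i => List.replicate (α i) i

/-- `X^α f = X_1^{α_1} ⋯ X_n^{α_n} f`. -/
noncomputable def vfPow {n : ℕ} (X : Fin n → (Fin n → ℝ) → (Fin n → ℝ)) (α : Fin n → ℕ)
    (f : (Fin n → ℝ) → ℝ) : (Fin n → ℝ) → ℝ :=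
  vfSeq X (multiList α) f

/-- Partial derivative `∂^α f`. -/
noncomputable def pdPow {n : ℕ} (α : Fin n → ℕ) (f : (Fin n → ℝ) → ℝ) : (Fin n → ℝ) → ℝ :=
  vfPow (fun i => fun _ => Pi.single i (1 : ℝ)) α f

/-- Lie bracket of two vector fields. -/
noncomputable def lieBk {n : ℕ} (X Y : (Fin n → ℝ) → (Fin n → ℝ)) : (Fin n → ℝ) → (Fin n → ℝ) :=
  fun x => fderiv ℝ Y x (X x) - fderiv ℝ X x (Y x)

/-- A weight sequence: non-decreasing, positive, starting at `1`. -/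
structure IsWeight {n : ℕ} (w : Fin n → ℕ) : Prop where
  mono : Monotone w
  pos : ∀ i, 0 < w i
  first : ∀ h : 0 < n, w ⟨0, h⟩ = 1

/-- An `H`-frame on `V`. -/
structure IsHFrame {n : ℕ} (w : Fin n → ℕ) (X : Fin n → (Fin n → ℝ) → (Fin n → ℝ))
    (V : Set (Fin n → ℝ)) : Prop where
  smooth : ∀ j, ContDiffOn ℝ (⊤ : ℕ∞) (X j) V
  basis : ∀ x ∈ V, LinearIndependent ℝ fun j => X j x
  bracket : ∃ L : Fin n → Fin n → Fin n → (Fin n → ℝ) → ℝ,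
    (∀ i j k, ContDiffOn ℝ (⊤ : ℕ∞) (L i j k) V) ∧
    (∀ i j k, ¬ w k ≤ w i + w j → ∀ x ∈ V, L i j k x = 0) ∧
    ∀ i j, ∀ x ∈ V, lieBk (X i) (X j) x = ∑ k, L i j k x • X k x

/-- `f` has order `≥ N` at `a` with respect to the frame `X`. -/
def OrderGe {n : ℕ} (w : Fin n → ℕ) (X : Fin n → (Fin n → ℝ) → (Fin n → ℝ))
    (f : (Fin n → ℝ) → ℝ) (a : Fin n → ℝ) (N : ℕ) : Prop :=
  ∀ I : List (Fin n), seqW w I < N → vfSeq X I f a = 0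

/-- `f` has order exactly `N` at `a` with respect to the frame `X`. -/
def OrderEq {n : ℕ} (w : Fin n → ℕ) (X : Fin n → (Fin n → ℝ) → (Fin n → ℝ))
    (f : (Fin n → ℝ) → ℝ) (a : Fin n → ℝ) (N : ℕ) : Prop :=
  OrderGe w X f a N ∧ ∃ I : List (Fin n), seqW w I = N ∧ vfSeq X I f a ≠ 0

/-- `f` has weight `≥ N`. -/
def WeightGe {n : ℕ} (w : Fin n → ℕ) (f : (Fin n → ℝ) → ℝ) (N : ℤ) : Prop :=
  ∀ α : Fin n → ℕ, (wlen w α : ℤ) < N → pdPow α f 0 = 0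

/-- `f` has weight exactly `N`. -/
def WeightEq {n : ℕ} (w : Fin n → ℕ) (f : (Fin n → ℝ) → ℝ) (N : ℤ) : Prop :=
  WeightGe w f N ∧ ∃ α : Fin n → ℕ, (wlen w α : ℤ) = N ∧ pdPow α f 0 ≠ 0

/-- A pseudo-norm for the anisotropic dilations. -/
structure IsPseudoNorm {n : ℕ} (w : Fin n → ℕ) (ρ : (Fin n → ℝ) → ℝ) : Prop where
  cont : Continuous ρ
  nonneg : ∀ x, 0 ≤ ρ x
  pos : ∀ x, x ≠ 0 → 0 < ρ x
  homog : ∀ t x, ρ (dil w t x) = |t| * ρ x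

/-- Multi-indices with all entries `< B`. -/
def mIdx (n B : ℕ) : Finset (Fin n → ℕ) := Fintype.piFinset fun _ => Finset.range B

/-- The monomial `x^α`. -/
def monom {n : ℕ} (α : Fin n → ℕ) (x : Fin n → ℝ) : ℝ := ∏ i, x i ^ α i

/-- Taylor coefficient `(1/α!) ∂^α f(0)`. -/
noncomputable def taylorCoeff {n : ℕ} (α : Fin n → ℕ) (f : (Fin n → ℝ) → ℝ) : ℝ :=
  ((∏ i, Nat.factorial (α i) : ℕ) : ℝ)⁻¹ * pdPow α f 0

/-- The homogeneous part `f^[ℓ]` of degree `ℓ` of the Taylor series of `f` at `0`. -/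
noncomputable def homPart {n : ℕ} (w : Fin n → ℕ) (f : (Fin n → ℝ) → ℝ) (ℓ : ℕ) :
    (Fin n → ℝ) → ℝ :=
  fun x => ∑ α ∈ (mIdx n (ℓ + 1)).filter (fun α => wlen w α = ℓ),
    taylorCoeff α f * monom α x

/-- `u_t = O(t^m)` in `C^∞(U)` as `t → 0`. -/
def BigOC {n : ℕ} (U : Set (Fin n → ℝ)) (u : ℝ → (Fin n → ℝ) → ℝ) (m : ℤ) : Prop :=
  ∀ K : Set (Fin n → ℝ), K ⊆ U → IsCompact K → ∀ β : Fin n → ℕ,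
    ∃ C : ℝ, ∀ᶠ t in 𝓝[≠] (0 : ℝ), ∀ x ∈ K, |pdPow β (u t) x| ≤ C * |t| ^ m

/-- Componentwise `O(t^m)` in `C^∞(U)` for families of vector fields. -/
def BigOCVF {n : ℕ} (U : Set (Fin n → ℝ)) (u : ℝ → (Fin n → ℝ) → Fin n → ℝ)
    (m : ℤ) : Prop :=
  ∀ K : Set (Fin n → ℝ), K ⊆ U → IsCompact K → ∀ β : Fin n → ℕ, ∀ k : Fin n,
    ∃ C : ℝ, ∀ᶠ t in 𝓝[≠] (0 : ℝ), ∀ x ∈ K,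
      |pdPow β (fun y => u t y k) x| ≤ C * |t| ^ m

/-- `Θ = O_w(‖x‖^{w+m})` near `x = 0`. -/
def IsOw {n : ℕ} (w : Fin n → ℕ) (ρ : (Fin n → ℝ) → ℝ)
    (Θ : (Fin n → ℝ) → (Fin n → ℝ)) (m : ℤ) : Prop :=
  ∀ k, ∃ C : ℝ, ∀ᶠ x in 𝓝 (0 : Fin n → ℝ), |Θ x k| ≤ C * ρ x ^ ((w k : ℤ) + m)

/-- A `w`-homogeneous map. -/
def WHomog {n : ℕ} (w : Fin n → ℕ) (φ : (Fin n → ℝ) → (Fin n → ℝ)) : Prop :=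
  ∀ t x, φ (dil w t x) = dil w t (φ x)

/-- A map whose components are polynomial functions. -/
def IsPolyMap {n : ℕ} (φ : (Fin n → ℝ) → (Fin n → ℝ)) : Prop :=
  ∀ k, ∃ p : MvPolynomial (Fin n) ℝ, ∀ x, φ x k = MvPolynomial.eval x p

/-- A vector field homogeneous of degree `m`: `δ_t^* Y = t^m Y` for `t ≠ 0`. -/
def VFHomog {n : ℕ} (w : Fin n → ℕ) (Y : (Fin n → ℝ) → (Fin n → ℝ)) (m : ℤ) : Prop :=
  ∀ t : ℝ, t ≠ 0 → ∀ x k, (t : ℝ) ^ (-(w k : ℤ)) * Y (dil w t x) k = t ^ m * Y x k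

/-- A vector field has weight `W`: each component `X_k` has weight `≥ W + w_k`,
with equality for some `k`. -/
def VFWeightEq {n : ℕ} (w : Fin n → ℕ) (X : (Fin n → ℝ) → (Fin n → ℝ)) (W : ℤ) :
    Prop :=
  (∀ k, ∀ α : Fin n → ℕ, (wlen w α : ℤ) < W + w k →
    pdPow α (fun y => X y k) 0 = 0) ∧
  ∃ k, ∃ α : Fin n → ℕ, (wlen w α : ℤ) = W + w k ∧ pdPow α (fun y => X y k) 0 ≠ 0

/-- The homogeneous part `X^[ℓ]` of degree `ℓ` of a vector field. -/
noncomputable def vfPart {n : ℕ} (w : Fin n → ℕ) (X : (Fin n → ℝ) → (Fin n → ℝ)) (ℓ : ℤ) :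
    (Fin n → ℝ) → Fin n → ℝ :=
  fun x k => ∑ α ∈ (mIdx n ((ℓ + w k).toNat + 1)).filter
      (fun α => (wlen w α : ℤ) = ℓ + w k),
    taylorCoeff α (fun y => X y k) * monom α x

/-- `φ` produces privileged coordinates at `a` adapted to the `H`-frame `X`:
it is linearly adapted at `a` and each component has order `w_k` at `a`. -/
def PrivilegedAt {n : ℕ} (w : Fin n → ℕ) (X : Fin n → (Fin n → ℝ) → (Fin n → ℝ))
    (a : Fin n → ℝ) (φ : (Fin n → ℝ) → (Fin n → ℝ)) : Prop :=
  (∀ j, fderiv ℝ φ a (X j a) = Pi.single j 1) ∧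
  ∀ k, OrderEq w X (fun x => φ x k) a (w k)


section Frames

variable {n : ℕ} {U : Set (Fin n → ℝ)} {X : Fin n → (Fin n → ℝ) → (Fin n → ℝ)}

lemma contDiffOn_vf {Y : (Fin n → ℝ) → (Fin n → ℝ)} {f : (Fin n → ℝ) → ℝ} (hU : IsOpen U)
    (hY : ContDiffOn ℝ (⊤ : ℕ∞) Y U) (hf : ContDiffOn ℝ (⊤ : ℕ∞) f U) :
    ContDiffOn ℝ (⊤ : ℕ∞) (vf Y f) U :=
  (hf.fderiv_of_isOpen hU (by simp)).clm_apply hY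

lemma contDiffOn_vfSeq {f : (Fin n → ℝ) → ℝ} (hU : IsOpen U)
    (hX : ∀ j, ContDiffOn ℝ (⊤ : ℕ∞) (X j) U) (hf : ContDiffOn ℝ (⊤ : ℕ∞) f U)
    (I : List (Fin n)) : ContDiffOn ℝ (⊤ : ℕ∞) (vfSeq X I f) U := by
  induction I with
  | nil => exact hf
  | cons i I ih => exact contDiffOn_vf hU (hX i) ih

lemma vfSeq_append (I J : List (Fin n)) (f : (Fin n → ℝ) → ℝ) :
    vfSeq X (I ++ J) f = vfSeq X I (vfSeq X J f) := by
  induction I with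
  | nil => rfl
  | cons i I ih => simp [vfSeq, ih]

lemma vf_congr {Y : (Fin n → ℝ) → (Fin n → ℝ)} {f g : (Fin n → ℝ) → ℝ} (hU : IsOpen U)
    (h : Set.EqOn f g U) : Set.EqOn (vf Y f) (vf Y g) U := fun x hx => by
  have : f =ᶠ[𝓝 x] g := Filter.eventuallyEq_of_mem (hU.mem_nhds hx) h
  simp only [vf, this.fderiv_eq]

lemma vfSeq_congr {f g : (Fin n → ℝ) → ℝ} (hU : IsOpen U) (h : Set.EqOn f g U)
    (I : List (Fin n)) : Set.EqOn (vfSeq X I f) (vfSeq X I g) U := by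
  induction I with
  | nil => exact h
  | cons i I ih => exact vf_congr hU ih

lemma differentiableAt_of_contDiffOn {f : (Fin n → ℝ) → ℝ} (hU : IsOpen U)
    (hf : ContDiffOn ℝ (⊤ : ℕ∞) f U) {x : Fin n → ℝ} (hx : x ∈ U) : DifferentiableAt ℝ f x :=
  (hf.contDiffAt (hU.mem_nhds hx)).differentiableAt (by simp)

lemma vf_add {Y : (Fin n → ℝ) → (Fin n → ℝ)} {f g : (Fin n → ℝ) → ℝ} (hU : IsOpen U)
    (hf : ContDiffOn ℝ (⊤ : ℕ∞) f U) (hg : ContDiffOn ℝ (⊤ : ℕ∞) g U) :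
    Set.EqOn (vf Y (f + g)) (vf Y f + vf Y g) U := fun x hx => by
  simp [vf,
    fderiv_add (differentiableAt_of_contDiffOn hU hf hx) (differentiableAt_of_contDiffOn hU hg hx)]

lemma vf_mul {Y : (Fin n → ℝ) → (Fin n → ℝ)} {f g : (Fin n → ℝ) → ℝ} (hU : IsOpen U)
    (hf : ContDiffOn ℝ (⊤ : ℕ∞) f U) (hg : ContDiffOn ℝ (⊤ : ℕ∞) g U) :
    Set.EqOn (vf Y (f * g)) (vf Y f * g + f * vf Y g) U := fun x hx => by
  simp [vf,
    fderiv_mul (differentiableAt_of_contDiffOn hU hf hx) (differentiableAt_of_contDiffOn hU hg hx)]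
  ring

lemma vf_const_smul (Y : (Fin n → ℝ) → (Fin n → ℝ)) (c : ℝ) (f : (Fin n → ℝ) → ℝ) :
    vf Y (c • f) = c • vf Y f := by
  ext x
  simp [vf, fderiv_const_smul_field]

lemma vfSeq_add {f g : (Fin n → ℝ) → ℝ} (hU : IsOpen U)
    (hX : ∀ j, ContDiffOn ℝ (⊤ : ℕ∞) (X j) U) (hf : ContDiffOn ℝ (⊤ : ℕ∞) f U)
    (hg : ContDiffOn ℝ (⊤ : ℕ∞) g U) (I : List (Fin n)) :
    Set.EqOn (vfSeq X I (f + g)) (vfSeq X I f + vfSeq X I g) U := by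
  induction I with
  | nil => exact fun _ _ => rfl
  | cons i I ih =>
    exact (vf_congr hU ih).trans
      (vf_add hU (contDiffOn_vfSeq hU hX hf I) (contDiffOn_vfSeq hU hX hg I))

lemma vfSeq_const_smul (c : ℝ) (f : (Fin n → ℝ) → ℝ) (I : List (Fin n)) :
    vfSeq X I (c • f) = c • vfSeq X I f := by
  induction I with
  | nil => rfl
  | cons i I ih => simp only [vfSeq, ih, vf_const_smul]

lemma vfSeq_zero (I : List (Fin n)) : vfSeq X I 0 = 0 := by
  simpa using vfSeq_const_smul (X := X) 0 0 I

lemma vfSeq_sum {ι : Type*} (s : Finset ι) {f : ι → (Fin n → ℝ) → ℝ} (hU : IsOpen U)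
    (hX : ∀ j, ContDiffOn ℝ (⊤ : ℕ∞) (X j) U) (hf : ∀ b, ContDiffOn ℝ (⊤ : ℕ∞) (f b) U)
    (I : List (Fin n)) :
    Set.EqOn (vfSeq X I (∑ b ∈ s, f b)) (∑ b ∈ s, vfSeq X I (f b)) U := by
  classical
  induction s using Finset.induction_on with
  | empty => simp [vfSeq_zero, Set.eqOn_refl]
  | insert b s hb ih =>
    rw [Finset.sum_insert hb, Finset.sum_insert hb]
    have hs : ContDiffOn ℝ (⊤ : ℕ∞) (∑ b ∈ s, f b) U := by
      rw [Finset.sum_fn]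
      exact ContDiffOn.sum fun b _ => hf b
    refine (vfSeq_add hU hX (hf b) hs I).trans fun x hx => ?_
    simp only [Pi.add_apply, ih hx]

/-- The coordinate frame `(∂_1, …, ∂_n)`. -/
def stdFrame (n : ℕ) : Fin n → (Fin n → ℝ) → (Fin n → ℝ) := fun i _ => Pi.single i (1 : ℝ)

lemma stdFrame_smooth (j : Fin n) : ContDiffOn ℝ (⊤ : ℕ∞) (stdFrame n j) U :=
  contDiff_const.contDiffOn

lemma pdPow_eq_vfSeq (α : Fin n → ℕ) (f : (Fin n → ℝ) → ℝ) :
    pdPow α f = vfSeq (stdFrame n) (multiList α) f := rfl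

lemma vf_eq_sum (Y : (Fin n → ℝ) → (Fin n → ℝ)) (f : (Fin n → ℝ) → ℝ) :
    vf Y f = ∑ k, (fun x => Y x k) * vf (stdFrame n k) f := by
  ext x
  have h : Y x = ∑ k, Y x k • (Pi.single k (1 : ℝ) : Fin n → ℝ) := by
    ext k
    simp [Finset.sum_apply, Pi.single_apply]
  simp only [vf, stdFrame, Finset.sum_apply, Pi.mul_apply]
  conv_lhs => rw [h]
  simp [map_sum]

lemma vf_coord (Y : (Fin n → ℝ) → (Fin n → ℝ)) (k : Fin n) :
    vf Y (fun x => x k) = fun x => Y x k := by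
  ext x
  have : HasFDerivAt (fun x : Fin n → ℝ => x k) (ContinuousLinearMap.proj (R := ℝ) k) x :=
    (ContinuousLinearMap.proj (R := ℝ) (φ := fun _ : Fin n => ℝ) k).hasFDerivAt
  simp [vf, this.fderiv]

lemma vf_stdFrame_comm {f : (Fin n → ℝ) → ℝ} (hU : IsOpen U)
    (hf : ContDiffOn ℝ (⊤ : ℕ∞) f U) (i j : Fin n) :
    Set.EqOn (vf (stdFrame n i) (vf (stdFrame n j) f))
      (vf (stdFrame n j) (vf (stdFrame n i) f)) U := fun x hx => by
  have hd : DifferentiableAt ℝ (fderiv ℝ f) x :=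
    ((hf.fderiv_of_isOpen hU (m := (⊤ : ℕ∞)) (by simp)).contDiffAt
      (hU.mem_nhds hx)).differentiableAt (by simp)
  have hs : IsSymmSndFDerivAt ℝ f x :=
    (hf.contDiffAt (hU.mem_nhds hx)).isSymmSndFDerivAt
      (by simpa using WithTop.coe_le_coe.2 (le_top : (2 : ℕ∞) ≤ ⊤))
  have key : ∀ u v : Fin n → ℝ,
      fderiv ℝ (fun y => fderiv ℝ f y u) x v = fderiv ℝ (fderiv ℝ f) x v u := fun u v => by
    rw [fderiv_clm_apply hd (differentiableAt_const u)]
    simp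
  change fderiv ℝ (fun y => fderiv ℝ f y _) x _ = fderiv ℝ (fun y => fderiv ℝ f y _) x _
  exact (key _ _).trans ((hs _ _).trans (key _ _).symm)

lemma vfSeq_stdFrame_perm {f : (Fin n → ℝ) → ℝ} (hU : IsOpen U)
    (hf : ContDiffOn ℝ (⊤ : ℕ∞) f U) {I J : List (Fin n)} (h : I.Perm J) :
    Set.EqOn (vfSeq (stdFrame n) I f) (vfSeq (stdFrame n) J f) U := by
  induction h with
  | nil => exact Set.eqOn_refl _ _
  | cons i _ ih => exact vf_congr hU ih
  | swap i j I => exact vf_stdFrame_comm hU (contDiffOn_vfSeq hU stdFrame_smooth hf I) j i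
  | trans _ _ ih₁ ih₂ => exact ih₁.trans ih₂

end Frames

section MultiIndices

variable {n : ℕ}

lemma count_multiList (α : Fin n → ℕ) (i : Fin n) : (multiList α).count i = α i := by
  simp only [multiList, List.count_flatMap, Function.comp_def, List.count_replicate, beq_iff_eq]
  have := Fin.sum_univ_def (fun j => if j = i then α j else 0)
  rw [← this]
  simp

lemma multiList_count_perm (I : List (Fin n)) : (multiList fun i => I.count i).Perm I :=
  List.perm_iff_count.2 fun i => count_multiList _ i

lemma seqW_eq_wlen_count (w : Fin n → ℕ) (I : List (Fin n)) :
    seqW w I = wlen w fun i => I.count i := by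
  induction I with
  | nil => simp [seqW, wlen]
  | cons j I ih =>
    simp only [seqW, List.map_cons, List.sum_cons] at ih ⊢
    rw [ih]
    simp [wlen, List.count_cons, mul_add, Finset.sum_add_distrib, add_comm]

lemma seqW_multiList (w : Fin n → ℕ) (α : Fin n → ℕ) : seqW w (multiList α) = wlen w α := by
  simp [seqW_eq_wlen_count, count_multiList]

lemma seqW_append (w : Fin n → ℕ) (I J : List (Fin n)) :
    seqW w (I ++ J) = seqW w I + seqW w J := by simp [seqW]

lemma seqW_cons (w : Fin n → ℕ) (i : Fin n) (I : List (Fin n)) :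
    seqW w (i :: I) = w i + seqW w I := by simp [seqW]

lemma wlen_one (α : Fin n → ℕ) : wlen (fun _ => 1) α = mlen α := by simp [wlen, mlen]

lemma le_wlen {w : Fin n → ℕ} (hw : ∀ i, 0 < w i) (α : Fin n → ℕ) (i : Fin n) :
    α i ≤ wlen w α :=
  (Nat.le_mul_of_pos_left _ (hw i)).trans
    (Finset.single_le_sum (f := fun i => w i * α i) (fun _ _ => Nat.zero_le _) (Finset.mem_univ i))

lemma mem_mIdx {B : ℕ} {α : Fin n → ℕ} : α ∈ mIdx n B ↔ ∀ i, α i < B := by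
  simp [mIdx, Fintype.mem_piFinset]

lemma monom_contDiff (α : Fin n → ℕ) : ContDiff ℝ (⊤ : ℕ∞) (monom α) := by
  unfold monom
  exact contDiff_prod fun i _ => (contDiff_apply ℝ ℝ i).pow _

lemma vf_stdFrame_monom (i : Fin n) (α : Fin n → ℕ) :
    vf (stdFrame n i) (monom α) = (α i : ℝ) • monom (α - Pi.single i 1) := by
  ext x
  have h : ∀ j ∈ Finset.univ, HasFDerivAt (fun x : Fin n → ℝ => x j ^ α j)
      ((α j * x j ^ (α j - 1) : ℝ) • ContinuousLinearMap.proj (R := ℝ) j) x := fun j _ => by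
    have h1 : HasFDerivAt (fun x : Fin n → ℝ => x j) (ContinuousLinearMap.proj (R := ℝ) j) x :=
      (ContinuousLinearMap.proj (R := ℝ) (φ := fun _ : Fin n => ℝ) j).hasFDerivAt
    simpa using h1.pow (α j)
  have := HasFDerivAt.finsetProd h
  simp only [vf, stdFrame]
  rw [show monom α = fun x => ∏ j, x j ^ α j from rfl, this.fderiv]
  simp only [sum_apply, smul_apply,
    ContinuousLinearMap.proj_apply, Pi.single_apply, smul_eq_mul, mul_ite, mul_one, mul_zero,
    Finset.sum_ite_eq', Finset.mem_univ, if_true, Pi.smul_apply, monom]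
  rw [← Finset.mul_prod_erase _ _ (Finset.mem_univ i), Finset.prod_congr rfl (g := fun j =>
    x j ^ (α - Pi.single i 1 : Fin n → ℕ) j) (s₁ := Finset.univ.erase i)]
  · simp
    ring
  · intro j hj
    simp [Finset.ne_of_mem_erase hj]

lemma vfSeq_stdFrame_monom (I : List (Fin n)) (α : Fin n → ℕ) :
    vfSeq (stdFrame n) I (monom α) =
      ((∏ i, (α i).descFactorial (I.count i) : ℕ) : ℝ) • monom (α - fun i => I.count i) := by
  induction I with
  | nil => ext x; simp [vfSeq, monom]
  | cons j I ih =>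
    rw [vfSeq, ih, vf_const_smul, vf_stdFrame_monom, smul_smul, ← Nat.cast_mul]
    congr 2
    · rw [← Finset.mul_prod_erase _ _ (Finset.mem_univ j),
        ← Finset.mul_prod_erase (a := j) _ (fun i => (α i).descFactorial ((j :: I).count i))
          (Finset.mem_univ j), List.count_cons_self, Nat.descFactorial_succ,
        Finset.prod_congr rfl (g := fun i => (α i).descFactorial ((j :: I).count i))
          (s₁ := Finset.univ.erase j)]
      · simp; ring
      · intro i hi
        rw [List.count_cons_of_ne (Finset.ne_of_mem_erase hi).symm]
    · ext i
      by_cases h : i = j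
      · subst h; simp; omega
      · simp [List.count_cons_of_ne (Ne.symm h), h]

lemma pdPow_monom (β α : Fin n → ℕ) :
    pdPow β (monom α) = ((∏ i, (α i).descFactorial (β i) : ℕ) : ℝ) • monom (α - β) := by
  rw [pdPow_eq_vfSeq, vfSeq_stdFrame_monom]
  simp [count_multiList]

lemma pdPow_monom_self (α : Fin n → ℕ) :
    pdPow α (monom α) = fun _ => ((∏ i, Nat.factorial (α i) : ℕ) : ℝ) := by
  ext x
  simp [pdPow_monom, Nat.descFactorial_self, monom]

lemma pdPow_monom_of_not_le {β α : Fin n → ℕ} (h : ¬ β ≤ α) : pdPow β (monom α) = 0 := by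
  obtain ⟨i, hi⟩ := not_forall.1 h
  rw [pdPow_monom, Finset.prod_eq_zero (Finset.mem_univ i)
    (Nat.descFactorial_of_lt (not_le.1 hi))]
  simp

lemma pdPow_monom_zero_of_ne {β α : Fin n → ℕ} (h : β ≠ α) : pdPow β (monom α) 0 = 0 := by
  by_cases hle : β ≤ α
  · obtain ⟨i, hi⟩ := Function.ne_iff.1 h
    have : (monom (α - β) : (Fin n → ℝ) → ℝ) 0 = 0 :=
      Finset.prod_eq_zero (Finset.mem_univ i) (by
        have : β i ≤ α i := hle i
        simp only [Pi.zero_apply, Pi.sub_apply]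
        exact zero_pow (by omega))
    simp [pdPow_monom, this]
  · simp [pdPow_monom_of_not_le hle]

end MultiIndices

section Order

variable {n : ℕ} {U : Set (Fin n → ℝ)} {w : Fin n → ℕ}
  {X : Fin n → (Fin n → ℝ) → (Fin n → ℝ)}

/-- Order `≥ N` at the origin with respect to a frame, for an integer `N`. For the coordinate
frame this is the weight. -/
def OrdGe (w : Fin n → ℕ) (X : Fin n → (Fin n → ℝ) → (Fin n → ℝ)) (f : (Fin n → ℝ) → ℝ)
    (N : ℤ) : Prop :=
  ∀ I : List (Fin n), (seqW w I : ℤ) < N → vfSeq X I f 0 = 0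

lemma orderGe_iff {f : (Fin n → ℝ) → ℝ} {N : ℕ} :
    OrderGe w X f 0 N ↔ OrdGe w X f N := by
  simp [OrderGe, OrdGe]

lemma weightGe_iff {f : (Fin n → ℝ) → ℝ} {N : ℤ} (hU : IsOpen U) (h0 : (0 : Fin n → ℝ) ∈ U)
    (hf : ContDiffOn ℝ (⊤ : ℕ∞) f U) : WeightGe w f N ↔ OrdGe w (stdFrame n) f N := by
  constructor
  · intro h I hI
    rw [← vfSeq_stdFrame_perm hU hf (multiList_count_perm I) h0]
    exact h _ (by rwa [← seqW_eq_wlen_count])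
  · intro h α hα
    exact h _ (by rwa [seqW_multiList])

lemma OrdGe.mono {f : (Fin n → ℝ) → ℝ} {M N : ℤ} (h : OrdGe w X f N) (hMN : M ≤ N) :
    OrdGe w X f M := fun I hI => h I (hI.trans_le hMN)

lemma ordGe_of_nonpos (f : (Fin n → ℝ) → ℝ) {N : ℤ} (hN : N ≤ 0) : OrdGe w X f N :=
  fun I hI => absurd hI (by omega)

lemma OrdGe.apply_zero {f : (Fin n → ℝ) → ℝ} {N : ℤ} (h : OrdGe w X f N) (hN : 0 < N) :
    f 0 = 0 := h [] (by simpa [seqW] using hN)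

lemma ordGe_zero (N : ℤ) : OrdGe w X 0 N := fun I _ => by simp [vfSeq_zero]

lemma OrdGe.vf_self {f : (Fin n → ℝ) → ℝ} {N : ℤ} (h : OrdGe w X f N) (i : Fin n) :
    OrdGe w X (vf (X i) f) (N - w i) := fun I hI => by
  have := h (I ++ [i]) (by rw [seqW_append]; simp [seqW] at hI ⊢; omega)
  rwa [vfSeq_append] at this

lemma OrdGe.vfSeq_self {f : (Fin n → ℝ) → ℝ} {N : ℤ} (h : OrdGe w X f N) (I : List (Fin n)) :
    OrdGe w X (vfSeq X I f) (N - seqW w I) := fun J hJ => by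
  have := h (J ++ I) (by rw [seqW_append]; push_cast; omega)
  rwa [vfSeq_append] at this

lemma OrdGe.congr {f g : (Fin n → ℝ) → ℝ} {N : ℤ} (hU : IsOpen U) (h0 : (0 : Fin n → ℝ) ∈ U)
    (h : OrdGe w X f N) (hfg : Set.EqOn f g U) : OrdGe w X g N := fun I hI => by
  rw [← vfSeq_congr hU hfg I h0, h I hI]

lemma OrdGe.const_smul {f : (Fin n → ℝ) → ℝ} {N : ℤ} (h : OrdGe w X f N) (c : ℝ) :
    OrdGe w X (c • f) N := fun I hI => by
  rw [vfSeq_const_smul, Pi.smul_apply, h I hI, smul_zero]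

lemma OrdGe.add (hU : IsOpen U) (h0 : (0 : Fin n → ℝ) ∈ U)
    (hX : ∀ j, ContDiffOn ℝ (⊤ : ℕ∞) (X j) U) {f g : (Fin n → ℝ) → ℝ} {N : ℤ}
    (hf : ContDiffOn ℝ (⊤ : ℕ∞) f U) (hg : ContDiffOn ℝ (⊤ : ℕ∞) g U)
    (h : OrdGe w X f N) (h' : OrdGe w X g N) : OrdGe w X (f + g) N := fun I hI => by
  rw [vfSeq_add hU hX hf hg I h0, Pi.add_apply, h I hI, h' I hI, add_zero]

lemma OrdGe.sum {ι : Type*} {s : Finset ι} (hU : IsOpen U) (h0 : (0 : Fin n → ℝ) ∈ U)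
    (hX : ∀ j, ContDiffOn ℝ (⊤ : ℕ∞) (X j) U) {f : ι → (Fin n → ℝ) → ℝ} {N : ℤ}
    (hf : ∀ b, ContDiffOn ℝ (⊤ : ℕ∞) (f b) U) (h : ∀ b ∈ s, OrdGe w X (f b) N) :
    OrdGe w X (∑ b ∈ s, f b) N := fun I hI => by
  rw [vfSeq_sum s hU hX hf I h0, Finset.sum_apply]
  exact Finset.sum_eq_zero fun b hb => h b hb I hI

lemma OrdGe.mul (hU : IsOpen U) (h0 : (0 : Fin n → ℝ) ∈ U)
    (hX : ∀ j, ContDiffOn ℝ (⊤ : ℕ∞) (X j) U) {f g : (Fin n → ℝ) → ℝ} {M N : ℤ}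
    (hf : ContDiffOn ℝ (⊤ : ℕ∞) f U) (hg : ContDiffOn ℝ (⊤ : ℕ∞) g U)
    (h : OrdGe w X f M) (h' : OrdGe w X g N) : OrdGe w X (f * g) (M + N) := by
  intro I
  induction I using List.reverseRecOn generalizing f g M N with
  | nil =>
    intro hI
    simp only [seqW, List.map_nil, List.sum_nil, Nat.cast_zero] at hI
    simp only [vfSeq, Pi.mul_apply]
    rcases lt_or_ge 0 M with hM | hM
    · rw [h.apply_zero hM, zero_mul]
    · rw [h'.apply_zero (by omega), mul_zero]
  | append_singleton I i ih =>
    intro hI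
    have hsub : (seqW w I : ℤ) < M + N - w i := by
      rw [seqW_append] at hI
      simp [seqW] at hI ⊢
      omega
    have hf' := contDiffOn_vf hU (hX i) hf
    have hg' := contDiffOn_vf hU (hX i) hg
    rw [vfSeq_append, vfSeq, vfSeq, vfSeq_congr hU (vf_mul hU hf hg) I h0,
      vfSeq_add hU hX (f := vf (X i) f * g) (g := f * vf (X i) g) (hf'.mul hg) (hf.mul hg') I h0,
      Pi.add_apply,
      ih hf' hg (h.vf_self i) h' (by omega), ih hf hg' h (h'.vf_self i) (by omega), add_zero]

lemma contDiff_coord (k : Fin n) : ContDiff ℝ (⊤ : ℕ∞) (fun x : Fin n → ℝ => x k) :=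
  contDiff_apply ℝ ℝ k

lemma ordGe_monom (hU : IsOpen U) (h0 : (0 : Fin n → ℝ) ∈ U)
    (hX : ∀ j, ContDiffOn ℝ (⊤ : ℕ∞) (X j) U) (h : ∀ k, OrdGe w X (fun x => x k) (w k))
    (α : Fin n → ℕ) : OrdGe w X (monom α) (wlen w α) := by
  have hpow : ∀ (k : Fin n) (m : ℕ), OrdGe w X (fun x => x k ^ m) (w k * m : ℤ) := by
    intro k m
    induction m with
    | zero => exact ordGe_of_nonpos _ (by simp)
    | succ m ih =>
      have := OrdGe.mul hU h0 hX ((contDiff_coord k).pow m).contDiffOn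
        (contDiff_coord k).contDiffOn ih (h k)
      rw [show (w k * (m + 1 : ℕ) : ℤ) = w k * m + w k by push_cast; ring]
      exact this
  have hprod : ∀ s : Finset (Fin n),
      OrdGe w X (fun x => ∏ i ∈ s, x i ^ α i) (∑ i ∈ s, (w i * α i : ℤ)) := by
    intro s
    induction s using Finset.induction_on with
    | empty => exact ordGe_of_nonpos _ (by simp)
    | insert k s hk ih =>
      have hs : ContDiff ℝ (⊤ : ℕ∞) (fun x : Fin n → ℝ => ∏ i ∈ s, x i ^ α i) :=
        contDiff_prod fun i _ => (contDiff_coord i).pow _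
      have := OrdGe.mul hU h0 hX ((contDiff_coord k).pow (α k)).contDiffOn hs.contDiffOn
        (hpow k (α k)) ih
      rw [Finset.sum_insert hk]
      convert this using 1
      ext x
      simp [Finset.prod_insert hk]
  simp only [wlen, Nat.cast_sum, Nat.cast_mul]
  exact hprod Finset.univ

lemma contDiffOn_component {Y : (Fin n → ℝ) → (Fin n → ℝ)} (hY : ContDiffOn ℝ (⊤ : ℕ∞) Y U)
    (k : Fin n) : ContDiffOn ℝ (⊤ : ℕ∞) (fun x => Y x k) U :=
  (contDiff_coord k).comp_contDiffOn hY

lemma OrdGe.vf_of_weight (hU : IsOpen U) (h0 : (0 : Fin n → ℝ) ∈ U)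
    {Y : (Fin n → ℝ) → (Fin n → ℝ)} (hY : ContDiffOn ℝ (⊤ : ℕ∞) Y U) {f : (Fin n → ℝ) → ℝ}
    (hf : ContDiffOn ℝ (⊤ : ℕ∞) f U) {W N : ℤ}
    (hW : ∀ k, OrdGe w (stdFrame n) (fun x => Y x k) (W + w k))
    (h : OrdGe w (stdFrame n) f N) : OrdGe w (stdFrame n) (vf Y f) (N + W) := by
  rw [vf_eq_sum]
  have hk := fun k => contDiffOn_vf hU (stdFrame_smooth k) hf
  refine OrdGe.sum hU h0 stdFrame_smooth (fun k => (contDiffOn_component hY k).mul (hk k))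
    fun k _ => ?_
  exact (OrdGe.mul hU h0 stdFrame_smooth (contDiffOn_component hY k) (hk k) (hW k) (h.vf_self k)).mono
    (by omega)

lemma OrdGe.vfSeq_of_weight (hU : IsOpen U) (h0 : (0 : Fin n → ℝ) ∈ U)
    (hX : ∀ j, ContDiffOn ℝ (⊤ : ℕ∞) (X j) U) {f : (Fin n → ℝ) → ℝ}
    (hf : ContDiffOn ℝ (⊤ : ℕ∞) f U) {N : ℤ}
    (hW : ∀ j k, OrdGe w (stdFrame n) (fun x => X j x k) (-w j + w k))
    (h : OrdGe w (stdFrame n) f N) (I : List (Fin n)) :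
    OrdGe w (stdFrame n) (vfSeq X I f) (N - seqW w I) := by
  induction I with
  | nil => simpa [seqW, vfSeq] using h
  | cons i I ih =>
    refine (OrdGe.vf_of_weight hU h0 (hX i) (contDiffOn_vfSeq hU hX hf I) (hW i) ih).mono ?_
    rw [seqW_cons]
    push_cast
    omega

/-- To leading isotropic order, a linearly adapted frame acts as the coordinate frame. -/
lemma OrdGe.vfSeq_sub_stdFrame (hU : IsOpen U) (h0 : (0 : Fin n → ℝ) ∈ U)
    (hX : ∀ j, ContDiffOn ℝ (⊤ : ℕ∞) (X j) U) (hX0 : ∀ j, X j 0 = Pi.single j 1)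
    {f : (Fin n → ℝ) → ℝ} (hf : ContDiffOn ℝ (⊤ : ℕ∞) f U) {N : ℤ}
    (h : OrdGe (fun _ => 1) (stdFrame n) f N) (I : List (Fin n)) :
    OrdGe (fun _ => 1) (stdFrame n)
      (vfSeq X I f + (-1 : ℝ) • vfSeq (stdFrame n) I f) (N - I.length + 1) := by
  induction I with
  | nil =>
    have : f + (-1 : ℝ) • f = 0 := by simp
    simpa only [vfSeq, this] using ordGe_zero _
  | cons i I ih =>
    have hl : ∀ I : List (Fin n), seqW (fun _ => 1) I = I.length := fun I => by simp [seqW]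
    have hXf := contDiffOn_vfSeq hU hX hf I
    have hEf := contDiffOn_vfSeq hU stdFrame_smooth hf I
    have hD : ContDiffOn ℝ (⊤ : ℕ∞)
        (vfSeq X I f + (-1 : ℝ) • vfSeq (stdFrame n) I f) U :=
      hXf.add (contDiffOn_const.smul hEf)
    have hZ : ContDiffOn ℝ (⊤ : ℕ∞) (fun x => X i x - stdFrame n i x) U :=
      (hX i).sub (stdFrame_smooth i)
    have h1 := OrdGe.vf_of_weight (W := -1) hU h0 (hX i) hD
      (fun k => ordGe_of_nonpos _ (by simp)) ih
    have h2 := OrdGe.vf_of_weight (W := 0) hU h0 hZ hEf (fun k J hJ => by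
      have : J = [] := by simpa [hl] using hJ
      simp [this, vfSeq, hX0, stdFrame]) (h.vfSeq_self I)
    rw [hl] at h2
    refine (OrdGe.add hU h0 stdFrame_smooth (contDiffOn_vf hU (hX i) hD)
      (contDiffOn_vf hU hZ hEf) (h1.mono (M := N - (i :: I).length + 1) ?_) (h2.mono ?_)).congr
      hU h0 fun x hx => ?_
    · simp
    · simp
    · have := vf_add (Y := X i) (g := (-1 : ℝ) • vfSeq (stdFrame n) I f) hU hXf
        (contDiffOn_const.smul hEf) hx
      simp only [Pi.add_apply, vfSeq, this, vf_const_smul]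
      simp [vf]
      ring

lemma vfSeq_stdFrame_taylor {f : (Fin n → ℝ) → ℝ} (hU : IsOpen U) (h0 : (0 : Fin n → ℝ) ∈ U)
    (hf : ContDiffOn ℝ (⊤ : ℕ∞) f U) (S : Finset (Fin n → ℕ)) (I : List (Fin n)) :
    vfSeq (stdFrame n) I (∑ β ∈ S, taylorCoeff β f • monom β) 0 =
      if (fun i => I.count i) ∈ S then vfSeq (stdFrame n) I f 0 else 0 := by
  set γ : Fin n → ℕ := fun i => I.count i with hγ
  have hm : ∀ β, ContDiffOn ℝ (⊤ : ℕ∞) (taylorCoeff β f • monom β) U :=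
    fun β => contDiffOn_const.smul (monom_contDiff β).contDiffOn
  have hI : ∀ g : (Fin n → ℝ) → ℝ, ContDiffOn ℝ (⊤ : ℕ∞) g U →
      vfSeq (stdFrame n) I g 0 = pdPow γ g 0 := fun g hg =>
    (vfSeq_stdFrame_perm hU hg (multiList_count_perm I) h0).symm
  have hfac : ((∏ i, Nat.factorial (γ i) : ℕ) : ℝ) ≠ 0 := by
    exact_mod_cast (Finset.prod_pos fun i _ => Nat.factorial_pos _).ne'
  rw [vfSeq_sum S hU stdFrame_smooth hm I h0, Finset.sum_apply, hI f hf]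
  have hterm : ∀ β ∈ S, vfSeq (stdFrame n) I (taylorCoeff β f • monom β) 0 =
      if γ = β then pdPow γ f 0 else 0 := fun β _ => by
    rw [vfSeq_const_smul, Pi.smul_apply, hI _ (monom_contDiff β).contDiffOn]
    split_ifs with h
    · rw [← h, pdPow_monom_self, taylorCoeff, smul_eq_mul, mul_right_comm, inv_mul_cancel₀ hfac,
        one_mul]
    · rw [pdPow_monom_zero_of_ne h, smul_zero]
  rw [Finset.sum_congr rfl hterm]
  simp

/-- In privileged coordinates, the weight of a function is at least its order. -/
lemma OrdGe.weight_of_order (hU : IsOpen U) (h0 : (0 : Fin n → ℝ) ∈ U)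
    (hX : ∀ j, ContDiffOn ℝ (⊤ : ℕ∞) (X j) U) (hX0 : ∀ j, X j 0 = Pi.single j 1)
    (hc : ∀ k, OrdGe w X (fun x => x k) (w k)) {f : (Fin n → ℝ) → ℝ}
    (hf : ContDiffOn ℝ (⊤ : ℕ∞) f U) {N : ℤ} (h : OrdGe w X f N) :
    OrdGe w (stdFrame n) f N := by
  intro I
  induction hm : I.length using Nat.strong_induction_on generalizing I with
  | _ m ih =>
  intro hI
  have hcount : ∀ J : List (Fin n), mlen (fun i => J.count i) = J.length := fun J => by
    rw [← wlen_one, ← seqW_eq_wlen_count]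
    simp [seqW]
  have hlen : ∀ β : Fin n → ℕ, (multiList β).length = mlen β := fun β => by
    rw [← hcount]
    simp [count_multiList]
  set S := (mIdx n m).filter fun β => mlen β < m with hS
  have hmem : ∀ β, β ∈ S ↔ mlen β < m := fun β => by
    simp only [hS, Finset.mem_filter, mem_mIdx, and_iff_right_iff_imp]
    intro hβ i
    have := le_wlen (w := fun _ => 1) (fun _ => one_pos) β i
    rw [wlen_one] at this
    omega
  set T : (Fin n → ℝ) → ℝ := ∑ β ∈ S, taylorCoeff β f • monom β with hT
  have hmono : ∀ β, ContDiffOn ℝ (⊤ : ℕ∞) (taylorCoeff β f • monom β) U :=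
    fun β => contDiffOn_const.smul (monom_contDiff β).contDiffOn
  have hTs : ContDiffOn ℝ (⊤ : ℕ∞) T U := by
    rw [hT, Finset.sum_fn]
    exact ContDiffOn.sum fun β _ => hmono β
  have hTo : OrdGe w X T N := OrdGe.sum hU h0 hX hmono fun β hβ => by
    rcases lt_or_ge (wlen w β : ℤ) N with hlt | hge
    · have : taylorCoeff β f = 0 := by
        rw [taylorCoeff, pdPow_eq_vfSeq, ih _ ((hmem β).1 hβ) _ (hlen β)
          (by rwa [seqW_multiList]), mul_zero]
      simpa [this] using ordGe_zero N
    · exact ((ordGe_monom hU h0 hX hc β).mono hge).const_smul _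
  set g := f + (-1 : ℝ) • T with hg
  have hnT : ContDiffOn ℝ (⊤ : ℕ∞) ((-1 : ℝ) • T) U := contDiffOn_const.smul hTs
  have hgs : ContDiffOn ℝ (⊤ : ℕ∞) g U := hf.add hnT
  have hgo : OrdGe w X g N := h.add hU h0 hX hf hnT (hTo.const_smul _)
  have hgE : ∀ J : List (Fin n), vfSeq (stdFrame n) J g 0 =
      if J.length < m then 0 else vfSeq (stdFrame n) J f 0 := fun J => by
    rw [hg, vfSeq_add hU stdFrame_smooth hf hnT J h0, Pi.add_apply, vfSeq_const_smul,
      Pi.smul_apply, hT, vfSeq_stdFrame_taylor hU h0 hf S J]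
    simp only [hmem, hcount]
    split_ifs <;> simp
  have hiso : OrdGe (fun _ => 1) (stdFrame n) g m := fun J hJ => by
    rw [hgE, if_pos (by simpa [seqW] using hJ)]
  have := (hiso.vfSeq_sub_stdFrame hU h0 hX hX0 hgs I).apply_zero (by omega)
  rw [Pi.add_apply, hgo I hI, Pi.smul_apply, hgE, if_neg (by omega)] at this
  simpa using this

end Order

section Dilations

variable {n : ℕ} {U : Set (Fin n → ℝ)} {w : Fin n → ℕ}

lemma dil_contDiff (w : Fin n → ℕ) (t : ℝ) : ContDiff ℝ (⊤ : ℕ∞) (dil w t) :=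
  contDiff_pi.2 fun i => contDiff_const.mul (contDiff_coord i)

lemma dil_zero_right (w : Fin n → ℕ) (t : ℝ) : dil w t 0 = 0 := by
  ext i
  simp [dil]

lemma dil_zero_left (hw : ∀ i, 0 < w i) (x : Fin n → ℝ) : dil w 0 x = 0 := by
  ext i
  simp [dil, (hw i).ne']

lemma hasFDerivAt_dil (w : Fin n → ℕ) (t : ℝ) (x : Fin n → ℝ) :
    HasFDerivAt (dil w t)
      (ContinuousLinearMap.pi fun i => t ^ w i •
        ContinuousLinearMap.proj (R := ℝ) (φ := fun _ : Fin n => ℝ) i) x :=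
  (ContinuousLinearMap.pi fun i => t ^ w i •
    ContinuousLinearMap.proj (R := ℝ) (φ := fun _ : Fin n => ℝ) i).hasFDerivAt

/-- Chain rule for iterated partial derivatives along a dilation. -/
lemma vfSeq_stdFrame_comp_dil {f : (Fin n → ℝ) → ℝ} (hU : IsOpen U)
    (hf : ContDiffOn ℝ (⊤ : ℕ∞) f U) (t : ℝ) (I : List (Fin n)) :
    Set.EqOn (vfSeq (stdFrame n) I fun y => f (dil w t y))
      (fun y => t ^ seqW w I * vfSeq (stdFrame n) I f (dil w t y)) (dil w t ⁻¹' U) := by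
  have hV : IsOpen (dil w t ⁻¹' U) := hU.preimage (dil_contDiff w t).continuous
  induction I with
  | nil => intro x _; simp [vfSeq, seqW]
  | cons i I ih =>
    intro x hx
    have hd := differentiableAt_of_contDiffOn hU (contDiffOn_vfSeq hU stdFrame_smooth hf I) hx
    have hc := (hd.hasFDerivAt.comp x (hasFDerivAt_dil w t x)).const_mul (t ^ seqW w I)
    rw [vfSeq, vf_congr hV ih hx, vf]
    rw [show (fun y => t ^ seqW w I * vfSeq (stdFrame n) I f (dil w t y)) =
      fun y => t ^ seqW w I * (vfSeq (stdFrame n) I f ∘ dil w t) y from rfl, hc.fderiv]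
    have hv : (ContinuousLinearMap.pi fun j => t ^ w j •
        ContinuousLinearMap.proj (R := ℝ) (φ := fun _ : Fin n => ℝ) j)
          (stdFrame n i x) = t ^ w i • stdFrame n i (dil w t x) := by
      ext j
      by_cases h : j = i
      · subst h; simp [stdFrame]
      · simp [stdFrame, h]
    simp only [smul_apply, ContinuousLinearMap.comp_apply, hv, map_smul,
      vfSeq, vf, seqW_cons, smul_eq_mul]
    ring

lemma dil_tendsto (hw : ∀ i, 0 < w i) {V : Set (Fin n → ℝ)} (hV : V ∈ 𝓝 (0 : Fin n → ℝ))
    (R : ℝ) : ∀ᶠ t in 𝓝 (0 : ℝ), ∀ x : Fin n → ℝ, ‖x‖ ≤ R → dil w t x ∈ V := by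
  obtain ⟨ε, hε, hball⟩ := Metric.mem_nhds_iff.1 hV
  have h1 : ∀ᶠ t : ℝ in 𝓝 0, |t| < 1 := by
    have := (continuous_abs (G := ℝ)).tendsto 0
    rw [abs_zero] at this
    exact this.eventually_lt_const one_pos
  have h2 : ∀ᶠ t : ℝ in 𝓝 0, |t| * R < ε := by
    have hc : Continuous fun t : ℝ => |t| * R := by fun_prop
    have := hc.tendsto 0
    simp only [abs_zero, zero_mul] at this
    exact this.eventually_lt_const hε
  filter_upwards [h1, h2] with t ht1 ht2 x hx
  refine hball (mem_ball_zero_iff.2 ((pi_norm_lt_iff hε).2 fun i => ?_))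
  calc ‖dil w t x i‖ = |t| ^ w i * |x i| := by simp [dil]
    _ ≤ |t| * R := by
        refine mul_le_mul (pow_le_of_le_one (abs_nonneg t) ht1.le (hw i).ne')
          ((norm_le_pi_norm x i).trans hx) (abs_nonneg _) (abs_nonneg _)
    _ < ε := ht2

lemma hasDerivAt_comp_dil {g : (Fin n → ℝ) → ℝ} (x : Fin n → ℝ) {s : ℝ}
    (hg : DifferentiableAt ℝ g (dil w s x)) :
    HasDerivAt (fun s => g (dil w s x))
      (∑ i, (w i * s ^ (w i - 1) * x i) * vf (stdFrame n i) g (dil w s x)) s := by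
  have hdil : HasDerivAt (fun s => dil w s x) (fun i => w i * s ^ (w i - 1) * x i) s :=
    hasDerivAt_pi.2 fun i => (hasDerivAt_pow (w i) s).mul_const (x i)
  have hsum := congrFun (vf_eq_sum (fun _ i => w i * s ^ (w i - 1) * x i) g) (dil w s x)
  have := hg.hasFDerivAt.comp_hasDerivAt s hdil
  rw [vf] at hsum
  rw [hsum] at this
  simp only [Finset.sum_apply, Pi.mul_apply] at this
  exact this

/-- A function of weight `≥ M` decays like `t ^ M` along dilations. -/
lemma OrdGe.decay (hw : ∀ i, 0 < w i) (hU : IsOpen U) (h0 : (0 : Fin n → ℝ) ∈ U) (R : ℝ)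
    (M : ℕ) {g : (Fin n → ℝ) → ℝ} (hg : ContDiffOn ℝ (⊤ : ℕ∞) g U)
    (h : OrdGe w (stdFrame n) g M) :
    ∃ C, 0 ≤ C ∧ ∀ᶠ t in 𝓝 (0 : ℝ), ∀ x : Fin n → ℝ, ‖x‖ ≤ R →
      |g (dil w t x)| ≤ C * |t| ^ M := by
  induction M using Nat.strong_induction_on generalizing g with
  | _ M ih =>
  rcases Nat.eq_zero_or_pos M with rfl | hM
  · have hc : ContinuousAt (fun y => |g y|) 0 :=
      (hg.continuousOn.continuousAt (hU.mem_nhds h0)).abs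
    have hb : {y | |g y| < |g 0| + 1} ∈ 𝓝 (0 : Fin n → ℝ) :=
      hc.eventually_lt_const (lt_add_one _)
    refine ⟨|g 0| + 1, by positivity, ?_⟩
    filter_upwards [dil_tendsto hw hb R] with t ht x hx
    simpa using (ht x hx).le
  · have hpart : ∀ i, ∃ C, 0 ≤ C ∧ ∀ᶠ t in 𝓝 (0 : ℝ), ∀ x : Fin n → ℝ, ‖x‖ ≤ R →
        |vf (stdFrame n i) g (dil w t x)| ≤ C * |t| ^ (M - w i) := fun i => by
      refine ih (M - w i) (by have := hw i; omega) (contDiffOn_vf hU (stdFrame_smooth i) hg) ?_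
      rcases le_total (w i) M with hle | hle
      · have := h.vf_self i
        rwa [← Nat.cast_sub hle] at this
      · exact ordGe_of_nonpos _ (by simp [Nat.sub_eq_zero_of_le hle])
    choose C hC0 hC using hpart
    refine ⟨∑ i, w i * |R| * C i, Finset.sum_nonneg fun i _ => by have := hC0 i; positivity, ?_⟩
    obtain ⟨δ, hδ, hall⟩ := Metric.eventually_nhds_iff.1
      ((eventually_all.2 hC).and (dil_tendsto hw (hU.mem_nhds h0) R))
    have hδ1 : ∀ᶠ t : ℝ in 𝓝 0, dist t 0 < min δ 1 :=
      Metric.ball_mem_nhds 0 (lt_min hδ one_pos)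
    filter_upwards [hδ1] with t ht x hx
    have hsmall : ∀ s ∈ Set.uIcc 0 t, |s| ≤ |t| := fun s hs => by
      simpa using Set.abs_sub_left_of_mem_uIcc hs
    have htδ : |t| < min δ 1 := by simpa using ht
    have hderiv : ∀ s ∈ Set.uIcc 0 t, HasDerivWithinAt (fun s => g (dil w s x))
        (∑ i, (w i * s ^ (w i - 1) * x i) * vf (stdFrame n i) g (dil w s x))
        (Set.uIcc 0 t) s := fun s hs => by
      have hsδ : dist s 0 < δ := by
        simpa using ((hsmall s hs).trans_lt htδ).trans_le (min_le_left _ _)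
      exact (hasDerivAt_comp_dil x
        (differentiableAt_of_contDiffOn hU hg ((hall hsδ).2 x hx))).hasDerivWithinAt
    have hbound : ∀ s ∈ Set.uIcc 0 t,
        ‖∑ i, (w i * s ^ (w i - 1) * x i) * vf (stdFrame n i) g (dil w s x)‖ ≤
          (∑ i, w i * |R| * C i) * |t| ^ (M - 1) := fun s hs => by
      have hst := hsmall s hs
      have hs1 : |s| ≤ 1 := hst.trans (htδ.le.trans (min_le_right _ _))
      have hsδ : dist s 0 < δ := by
        simpa using (hst.trans_lt htδ).trans_le (min_le_left _ _)
      rw [Finset.sum_mul]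
      refine norm_sum_le_of_le _ fun i _ => ?_
      have hxi : |x i| ≤ |R| := (norm_le_pi_norm x i).trans (hx.trans (le_abs_self R))
      have hv := (hall hsδ).1 i x hx
      have hpow : |s| ^ (w i - 1) * |s| ^ (M - w i) ≤ |t| ^ (M - 1) := by
        rw [← pow_add]
        exact (pow_le_pow_of_le_one (abs_nonneg s) hs1 (by have := hw i; omega)).trans
          (pow_le_pow_left₀ (abs_nonneg s) hst _)
      have hCi := hC0 i
      calc ‖(w i * s ^ (w i - 1) * x i) * vf (stdFrame n i) g (dil w s x)‖
          = (w i * |s| ^ (w i - 1)) * |x i| * |vf (stdFrame n i) g (dil w s x)| := by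
            simp
        _ ≤ (w i * |s| ^ (w i - 1)) * |R| * (C i * |s| ^ (M - w i)) := by gcongr
        _ = (w i * |R| * C i) * (|s| ^ (w i - 1) * |s| ^ (M - w i)) := by ring
        _ ≤ (w i * |R| * C i) * |t| ^ (M - 1) := by gcongr
    have := (convex_uIcc (0 : ℝ) t).norm_image_sub_le_of_norm_hasDerivWithin_le hderiv hbound
      Set.left_mem_uIcc Set.right_mem_uIcc
    rw [dil_zero_left hw, h.apply_zero (by exact_mod_cast hM), sub_zero, sub_zero, mul_assoc,
      Real.norm_eq_abs, Real.norm_eq_abs, ← pow_succ, Nat.sub_add_cancel hM] at this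
    exact this

lemma monom_dil (t : ℝ) (α : Fin n → ℕ) (x : Fin n → ℝ) :
    monom α (dil w t x) = t ^ wlen w α * monom α x := by
  simp only [monom, dil, wlen, mul_pow, Finset.prod_mul_distrib, ← pow_mul,
    Finset.prod_pow_eq_pow_sum]

end Dilations

section Characterization

variable {n : ℕ} {U : Set (Fin n → ℝ)} {w : Fin n → ℕ}

lemma multiList_single (k : Fin n) : multiList (Pi.single k 1) = [k] := by
  have h : (fun i => [k].count i) = Pi.single k 1 := by
    ext i
    by_cases hik : i = k
    · simp [hik]
    · simp [hik, Ne.symm hik]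
  have := multiList_count_perm [k]
  rwa [h, List.perm_singleton] at this

lemma ordGe_coord (w : Fin n → ℕ) (k : Fin n) : OrdGe w (stdFrame n) (fun x => x k) (w k) := by
  intro I hI
  rcases List.eq_nil_or_concat I with rfl | ⟨J, i, rfl⟩
  · rfl
  · rw [List.concat_eq_append, vfSeq_append, vfSeq, vfSeq, vf_coord]
    rw [List.concat_eq_append, seqW_append] at hI
    by_cases hik : k = i
    · subst hik
      rw [show seqW w [k] = w k by simp [seqW]] at hI
      push_cast at hI
      omega
    · have : (fun x => stdFrame n i x k) = 0 := by
        ext x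
        simp [stdFrame, hik]
      simp [this, vfSeq_zero]

lemma wlen_single (w : Fin n → ℕ) (k : Fin n) : wlen w (Pi.single k 1) = w k := by
  simp [← seqW_multiList, multiList_single, seqW]

lemma vfWeightEq_iff (hU : IsOpen U) (h0 : (0 : Fin n → ℝ) ∈ U) {Y : (Fin n → ℝ) → (Fin n → ℝ)}
    (hY : ContDiffOn ℝ (⊤ : ℕ∞) Y U) {j : Fin n} (hY0 : Y 0 = Pi.single j 1) :
    VFWeightEq w Y (-(w j : ℤ)) ↔
      ∀ k, OrdGe w (stdFrame n) (fun x => Y x k) (-(w j : ℤ) + w k) := by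
  have hk := fun k => weightGe_iff (w := w) (N := -(w j : ℤ) + w k) hU h0
    (contDiffOn_component hY k)
  refine ⟨fun h k => (hk k).1 (h.1 k), fun h => ⟨fun k => (hk k).2 (h k), j, 0, ?_, ?_⟩⟩
  · simp [wlen]
  · have : multiList (0 : Fin n → ℕ) = [] := by simp [multiList]
    simp [pdPow, vfPow, this, vfSeq, hY0]

lemma vfPart_apply (Y : (Fin n → ℝ) → (Fin n → ℝ)) (ℓ : ℤ) (k : Fin n) :
    (fun x => vfPart w Y ℓ x k) =
      ∑ β ∈ (mIdx n ((ℓ + w k).toNat + 1)).filter (fun β => (wlen w β : ℤ) = ℓ + w k),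
        taylorCoeff β (fun y => Y y k) • monom β := by
  ext x
  simp [vfPart]

lemma vfPart_contDiff (Y : (Fin n → ℝ) → (Fin n → ℝ)) (ℓ : ℤ) :
    ContDiff ℝ (⊤ : ℕ∞) (vfPart w Y ℓ) :=
  contDiff_pi.2 fun _ => ContDiff.sum fun β _ => contDiff_const.mul (monom_contDiff β)

lemma vfPart_dil (Y : (Fin n → ℝ) → (Fin n → ℝ)) (ℓ : ℤ) (t : ℝ) (x : Fin n → ℝ) (k : Fin n) :
    vfPart w Y ℓ (dil w t x) k = t ^ (ℓ + w k) * vfPart w Y ℓ x k := by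
  simp only [vfPart, Finset.mul_sum]
  refine Finset.sum_congr rfl fun β hβ => ?_
  rw [monom_dil, ← (Finset.mem_filter.1 hβ).2, zpow_natCast]
  ring

lemma vfPart_homog (Y : (Fin n → ℝ) → (Fin n → ℝ)) (ℓ : ℤ) : VFHomog w (vfPart w Y ℓ) ℓ := by
  intro t ht x k
  rw [vfPart_dil, ← mul_assoc, ← zpow_add₀ ht, neg_add_cancel_comm_assoc]

/-- Removing the part of lowest degree of a vector field raises its weight. -/
lemma ordGe_sub_vfPart (hw : ∀ i, 0 < w i) (hU : IsOpen U) (h0 : (0 : Fin n → ℝ) ∈ U)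
    {Y : (Fin n → ℝ) → (Fin n → ℝ)} (hY : ContDiffOn ℝ (⊤ : ℕ∞) Y U) {ℓ : ℤ} {k : Fin n}
    (h : OrdGe w (stdFrame n) (fun x => Y x k) (ℓ + w k)) :
    OrdGe w (stdFrame n) ((fun x => Y x k) + (-1 : ℝ) • fun x => vfPart w Y ℓ x k)
      (ℓ + w k + 1) := by
  intro I hI
  have hf := contDiffOn_component hY k
  have hP : ContDiffOn ℝ (⊤ : ℕ∞) ((-1 : ℝ) • fun x => vfPart w Y ℓ x k) U :=
    contDiffOn_const.smul (contDiffOn_component (vfPart_contDiff Y ℓ).contDiffOn k)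
  rw [vfSeq_add hU stdFrame_smooth hf hP I h0, Pi.add_apply, vfSeq_const_smul, Pi.smul_apply,
    vfPart_apply, vfSeq_stdFrame_taylor hU h0 hf]
  split_ifs with hS
  · simp
  · rw [h I, smul_zero, add_zero]
    refine lt_of_le_of_ne (by omega) fun heq => hS ?_
    rw [Finset.mem_filter, ← seqW_eq_wlen_count]
    refine ⟨mem_mIdx.2 fun i => ?_, heq⟩
    have := le_wlen hw (fun i => I.count i) i
    rw [← seqW_eq_wlen_count] at this
    omega

lemma bigOCVF_of_weight (hw : ∀ i, 0 < w i) (hU : IsOpen U) (h0 : (0 : Fin n → ℝ) ∈ U)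
    {Y : (Fin n → ℝ) → (Fin n → ℝ)} (hY : ContDiffOn ℝ (⊤ : ℕ∞) Y U) {ℓ : ℤ}
    (h : ∀ k, OrdGe w (stdFrame n) (fun x => Y x k) (ℓ + w k)) :
    BigOCVF U (fun t x k => t ^ (-ℓ - (w k : ℤ)) * Y (dil w t x) k - vfPart w Y ℓ x k) 1 := by
  intro K _ hK β k
  obtain ⟨R, hR⟩ := hK.isBounded.exists_norm_le
  set f : (Fin n → ℝ) → ℝ := (fun x => Y x k) + (-1 : ℝ) • fun x => vfPart w Y ℓ x k with hf
  have hfs : ContDiffOn ℝ (⊤ : ℕ∞) f U := (contDiffOn_component hY k).add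
    (contDiffOn_const.smul (contDiffOn_component (vfPart_contDiff Y ℓ).contDiffOn k))
  set M : ℕ := (ℓ + w k + 1 - wlen w β).toNat with hM
  have hfo : OrdGe w (stdFrame n) (vfSeq (stdFrame n) (multiList β) f) M := by
    rcases le_total 0 (ℓ + w k + 1 - wlen w β) with hle | hle
    · rw [hM, Int.toNat_of_nonneg hle, ← seqW_multiList]
      exact (ordGe_sub_vfPart hw hU h0 hY (h k)).vfSeq_self _
    · exact ordGe_of_nonpos _ (by simp [hM, Int.toNat_of_nonpos hle])
  obtain ⟨C, hC0, hC⟩ := hfo.decay hw hU h0 R M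
    (contDiffOn_vfSeq hU stdFrame_smooth hfs (multiList β))
  have h1 : ∀ᶠ t : ℝ in 𝓝 0, dist t 0 < 1 := Metric.ball_mem_nhds 0 one_pos
  refine ⟨C, ?_⟩
  filter_upwards [hC.filter_mono nhdsWithin_le_nhds, h1.filter_mono nhdsWithin_le_nhds,
    (dil_tendsto hw (hU.mem_nhds h0) R).filter_mono nhdsWithin_le_nhds,
    self_mem_nhdsWithin] with t htC ht1 htU ht0 x hx
  have ht0' : t ≠ 0 := ht0
  have hpos : 0 < |t| := abs_pos.2 ht0'
  have hfun : (fun y => t ^ (-ℓ - (w k : ℤ)) * Y (dil w t y) k - vfPart w Y ℓ y k) =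
      t ^ (-ℓ - (w k : ℤ)) • fun y => f (dil w t y) := by
    ext y
    have : t ^ (-ℓ - (w k : ℤ)) * t ^ (ℓ + w k) = 1 := by
      rw [← zpow_add₀ ht0']
      simp
    simp only [hf, Pi.add_apply, Pi.smul_apply, smul_eq_mul, vfPart_dil]
    linear_combination (vfPart w Y ℓ y k) * this
  rw [hfun, pdPow_eq_vfSeq, vfSeq_const_smul, Pi.smul_apply,
    vfSeq_stdFrame_comp_dil hU hfs t _ (htU x (hR x hx)), seqW_multiList, smul_eq_mul, abs_mul,
    abs_mul, abs_zpow, abs_pow]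
  calc |t| ^ (-ℓ - (w k : ℤ)) *
        (|t| ^ wlen w β * |vfSeq (stdFrame n) (multiList β) f (dil w t x)|)
      ≤ |t| ^ (-ℓ - (w k : ℤ)) * (|t| ^ wlen w β * (C * |t| ^ M)) := by
        have := htC x (hR x hx)
        gcongr
    _ = C * |t| ^ (-ℓ - (w k : ℤ) + wlen w β + M) := by
        rw [zpow_add₀ hpos.ne', zpow_add₀ hpos.ne', zpow_natCast, zpow_natCast]
        ring
    _ ≤ C * |t| ^ (1 : ℤ) := by
        refine mul_le_mul_of_nonneg_left (zpow_le_zpow_right_of_le_one₀ hpos ?_ (by omega)) hC0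
        simpa using ht1.le

lemma weight_of_bigOCVF (hU : IsOpen U) (h0 : (0 : Fin n → ℝ) ∈ U)
    {Y Z : (Fin n → ℝ) → (Fin n → ℝ)} (hY : ContDiffOn ℝ (⊤ : ℕ∞) Y U)
    (hZ : ContDiff ℝ (⊤ : ℕ∞) Z) {ℓ : ℤ}
    (h : BigOCVF U (fun t x k => t ^ (-ℓ - (w k : ℤ)) * Y (dil w t x) k - Z x k) 1) (k : Fin n) :
    OrdGe w (stdFrame n) (fun x => Y x k) (ℓ + w k) := by
  have hf := contDiffOn_component hY k
  rw [← weightGe_iff hU h0 hf]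
  intro α hα
  obtain ⟨C, hC⟩ := h {0} (Set.singleton_subset_iff.2 h0) isCompact_singleton α k
  obtain ⟨p, hp⟩ : ∃ p : ℕ, ℓ + w k - wlen w α = p + 1 :=
    ⟨(ℓ + w k - wlen w α - 1).toNat, by omega⟩
  set c := pdPow α (fun x => Y x k) 0 with hc
  set d := pdPow α (fun x => Z x k) 0 with hd
  have hlim : Tendsto (fun t : ℝ => |t| ^ (p + 1) * (|d| + C * |t|)) (𝓝[≠] 0) (𝓝 0) := by
    have hcont : Continuous fun t : ℝ => |t| ^ (p + 1) * (|d| + C * |t|) := by fun_prop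
    have := hcont.tendsto 0
    simp only [abs_zero, ne_eq, Nat.add_eq_zero_iff, one_ne_zero, and_false, not_false_eq_true,
      zero_pow, zero_mul] at this
    exact this.mono_left nhdsWithin_le_nhds
  have hle : |c| ≤ 0 := by
    refine ge_of_tendsto hlim ?_
    filter_upwards [hC, self_mem_nhdsWithin] with t ht ht0
    have ht0' : t ≠ 0 := ht0
    have hpos : 0 < |t| := abs_pos.2 ht0'
    have h0V : (0 : Fin n → ℝ) ∈ dil w t ⁻¹' U := by simpa [dil_zero_right] using h0
    have hV : IsOpen (dil w t ⁻¹' U) := hU.preimage (dil_contDiff w t).continuous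
    have hfd : ContDiffOn ℝ (⊤ : ℕ∞) (fun y => Y (dil w t y) k) (dil w t ⁻¹' U) :=
      hf.comp (dil_contDiff w t).contDiffOn fun _ hx => hx
    have hval : pdPow α (fun y => t ^ (-ℓ - (w k : ℤ)) * Y (dil w t y) k - Z y k) 0 =
        t ^ (-(p + 1 : ℕ) : ℤ) * c - d := by
      have hfun : (fun y => t ^ (-ℓ - (w k : ℤ)) * Y (dil w t y) k - Z y k) =
          (t ^ (-ℓ - (w k : ℤ)) • fun y => Y (dil w t y) k) + (-1 : ℝ) • fun y => Z y k := by
        ext y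
        simp [sub_eq_add_neg]
      rw [hfun, pdPow_eq_vfSeq, vfSeq_add hV stdFrame_smooth
        (f := t ^ (-ℓ - (w k : ℤ)) • fun y => Y (dil w t y) k) (g := (-1 : ℝ) • fun y => Z y k)
        (contDiffOn_const.smul hfd)
        (contDiffOn_const.smul (contDiffOn_component hZ.contDiffOn k)) _ h0V, Pi.add_apply,
        vfSeq_const_smul, vfSeq_const_smul, Pi.smul_apply, Pi.smul_apply,
        vfSeq_stdFrame_comp_dil hU hf t _ h0V, seqW_multiList]
      beta_reduce
      rw [dil_zero_right, ← pdPow_eq_vfSeq, ← pdPow_eq_vfSeq, ← hc, ← hd, smul_eq_mul,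
        smul_eq_mul, ← mul_assoc,
        ← zpow_natCast, ← zpow_add₀ ht0']
      rw [show -ℓ - (w k : ℤ) + wlen w α = (-(p + 1 : ℕ) : ℤ) by push_cast; omega]
      ring
    have hb := ht 0 rfl
    rw [hval, zpow_one] at hb
    have hcd : |t ^ (-(p + 1 : ℕ) : ℤ) * c| ≤ |d| + C * |t| := by
      have := abs_add_le (t ^ (-(p + 1 : ℕ) : ℤ) * c - d) d
      rw [sub_add_cancel] at this
      linarith
    calc |c| = |t| ^ (p + 1) * |t ^ (-(p + 1 : ℕ) : ℤ) * c| := by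
          rw [abs_mul, abs_zpow, zpow_neg, zpow_natCast, mul_inv_cancel_left₀ (by positivity)]
      _ ≤ |t| ^ (p + 1) * (|d| + C * |t|) := by gcongr
  exact abs_eq_zero.1 (le_antisymm hle (abs_nonneg c))

/-- The coefficients of `X^α` have weight at least `⟨β⟩ - ⟨α⟩` when each `X_j` has weight at
least `-w_j`. -/
lemma ordGe_coeff {X : Fin n → (Fin n → ℝ) → (Fin n → ℝ)} (hU : IsOpen U)
    (h0 : (0 : Fin n → ℝ) ∈ U) (hX : ∀ j, ContDiffOn ℝ (⊤ : ℕ∞) (X j) U)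
    (hW : ∀ j k, OrdGe w (stdFrame n) (fun x => X j x k) (-(w j : ℤ) + w k)) {α : Fin n → ℕ}
    {S : Finset (Fin n → ℕ)} {a : (Fin n → ℕ) → (Fin n → ℝ) → ℝ}
    (ha : ∀ β, ContDiffOn ℝ (⊤ : ℕ∞) (a β) U)
    (hrep : ∀ f : (Fin n → ℝ) → ℝ, ContDiff ℝ (⊤ : ℕ∞) f → ∀ x ∈ U,
      vfPow X α f x = ∑ β ∈ S, a β x * pdPow β f x) {γ : Fin n → ℕ} (hγ : γ ∈ S) :
    OrdGe w (stdFrame n) (a γ) ((wlen w γ : ℤ) - wlen w α) := by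
  induction hm : mlen γ using Nat.strong_induction_on generalizing γ with
  | _ m ih =>
  have hmon : OrdGe w (stdFrame n) (monom γ) (wlen w γ) :=
    ordGe_monom hU h0 stdFrame_smooth (ordGe_coord w) γ
  have hγs : ContDiffOn ℝ (⊤ : ℕ∞) (monom γ) U := (monom_contDiff γ).contDiffOn
  have hpd : ∀ β, ContDiffOn ℝ (⊤ : ℕ∞) (pdPow β (monom γ)) U := fun β =>
    contDiffOn_vfSeq hU stdFrame_smooth hγs _
  have hlhs : OrdGe w (stdFrame n) (vfPow X α (monom γ)) ((wlen w γ : ℤ) - wlen w α) := by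
    rw [← seqW_multiList w α]
    exact hmon.vfSeq_of_weight hU h0 hX hγs hW _
  set g : (Fin n → ℝ) → ℝ := ∑ β ∈ S.erase γ, a β * pdPow β (monom γ) with hg
  have hgs : ContDiffOn ℝ (⊤ : ℕ∞) g U := by
    rw [hg, Finset.sum_fn]
    exact ContDiffOn.sum fun β _ => (ha β).mul (hpd β)
  have hgo : OrdGe w (stdFrame n) g ((wlen w γ : ℤ) - wlen w α) := by
    refine OrdGe.sum hU h0 stdFrame_smooth (fun β => (ha β).mul (hpd β)) fun β hβ => ?_
    obtain ⟨hne, hβS⟩ := Finset.mem_erase.1 hβ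
    by_cases hle : β ≤ γ
    · have hlt : mlen β < m := by
        rw [← hm]
        obtain ⟨i, hi⟩ := Function.ne_iff.1 hne
        exact Finset.sum_lt_sum (fun i _ => hle i)
          ⟨i, Finset.mem_univ i, lt_of_le_of_ne (hle i) hi⟩
      have h2 := hmon.vfSeq_self (multiList β)
      rw [seqW_multiList, ← pdPow_eq_vfSeq] at h2
      exact (OrdGe.mul hU h0 stdFrame_smooth (ha β) (hpd β) (ih _ hlt hβS rfl) h2).mono (by omega)
    · rw [pdPow_monom_of_not_le hle, mul_zero]
      exact ordGe_zero _
  have hfac : ((∏ i, Nat.factorial (γ i) : ℕ) : ℝ) ≠ 0 := by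
    exact_mod_cast (Finset.prod_pos fun i _ => Nat.factorial_pos _).ne'
  have hXs : ContDiffOn ℝ (⊤ : ℕ∞) (vfPow X α (monom γ)) U := contDiffOn_vfSeq hU hX hγs _
  refine ((OrdGe.add hU h0 stdFrame_smooth hXs (hgs.const_smul (-1 : ℝ)) hlhs
    (hgo.const_smul (-1))).const_smul ((∏ i, Nat.factorial (γ i) : ℕ) : ℝ)⁻¹).congr hU h0
    fun x hx => ?_
  have := hrep _ (monom_contDiff γ) x hx
  rw [← Finset.add_sum_erase _ _ hγ, pdPow_monom_self] at this
  simp only [hg, Pi.smul_apply, Pi.add_apply, Finset.sum_apply, Pi.mul_apply, this, smul_eq_mul]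
  field_simp
  ring

/-- The coefficient of `∂^α` in `X^α` does not vanish at the origin. -/
lemma coeff_self_ne_zero {X : Fin n → (Fin n → ℝ) → (Fin n → ℝ)} (hU : IsOpen U)
    (h0 : (0 : Fin n → ℝ) ∈ U) (hX : ∀ j, ContDiffOn ℝ (⊤ : ℕ∞) (X j) U)
    (hX0 : ∀ j, X j 0 = Pi.single j 1) {α : Fin n → ℕ} {S : Finset (Fin n → ℕ)}
    {a : (Fin n → ℕ) → (Fin n → ℝ) → ℝ}
    (hrep : ∀ f : (Fin n → ℝ) → ℝ, ContDiff ℝ (⊤ : ℕ∞) f → ∀ x ∈ U,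
      vfPow X α f x = ∑ β ∈ S, a β x * pdPow β f x) :
    a α 0 ≠ 0 := by
  have hfac : ((∏ i, Nat.factorial (α i) : ℕ) : ℝ) ≠ 0 := by
    exact_mod_cast (Finset.prod_pos fun i _ => Nat.factorial_pos _).ne'
  have hαs : ContDiffOn ℝ (⊤ : ℕ∞) (monom α) U := (monom_contDiff α).contDiffOn
  have hlen : (multiList α).length = mlen α := by
    rw [← wlen_one, ← seqW_multiList]
    simp [seqW]
  have hmon : OrdGe (fun _ => 1) (stdFrame n) (monom α) (mlen α) := by
    rw [← weightGe_iff hU h0 hαs]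
    refine fun β hβ => pdPow_monom_zero_of_ne fun h => ?_
    rw [h, wlen_one] at hβ
    exact lt_irrefl _ hβ
  have h1 := (hmon.vfSeq_sub_stdFrame hU h0 hX hX0 hαs (multiList α)).apply_zero
    (by rw [hlen]; omega)
  have h2 := hrep _ (monom_contDiff α) 0 h0
  intro hzero
  rw [Finset.sum_eq_zero fun β _ => ?_] at h2
  · rw [Pi.add_apply, Pi.smul_apply, ← pdPow_eq_vfSeq, pdPow_monom_self] at h1
    change vfPow X α (monom α) 0 + _ = 0 at h1
    rw [h2] at h1
    exact hfac (by simpa using h1)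
  · by_cases hβ : β = α
    · rw [hβ, hzero, zero_mul]
    · rw [pdPow_monom_zero_of_ne hβ, mul_zero]

end Characterization

/-- Characterization of privileged coordinates: for a linearly
adapted `H`-frame, being privileged is equivalent to the convergence of the
rescaled vector fields, to the weights of the `X_j`, and to the weights of the
coefficients of the operators `X^α`. -/
theorem privileged_tfae
    {n : ℕ} (hn : 0 < n) {w : Fin n → ℕ} (hw : IsWeight w)
    {U : Set (Fin n → ℝ)} (hU : IsOpen U) (h0 : (0 : Fin n → ℝ) ∈ U)
    {X : Fin n → (Fin n → ℝ) → (Fin n → ℝ)} (hX : IsHFrame w X U)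
    (hX0 : ∀ j, X j 0 = Pi.single j 1) :
    List.TFAE [
      -- (i) the coordinates are privileged at 0
      ∀ k, OrderEq w X (fun x => x k) 0 (w k),
      -- (ii) t^{w_j} δ_t^* X_j = X_j^{(0)} + O(t) in C^∞(U) with X_j^{(0)}
      -- homogeneous of degree -w_j
      ∀ j, ∃ Y : (Fin n → ℝ) → (Fin n → ℝ),
        ContDiff ℝ (⊤ : ℕ∞) Y ∧ VFHomog w Y (-(w j : ℤ)) ∧
        BigOCVF U
          (fun t x k => (t : ℝ) ^ ((w j : ℤ) - (w k : ℤ)) * X j (dil w t x) k -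
            Y x k) 1,
      -- (iii) each X_j has weight -w_j
      ∀ j, VFWeightEq w (X j) (-(w j : ℤ)),
      -- (iv) each operator X^α has weight -⟨α⟩
      ∀ α : Fin n → ℕ, 1 ≤ mlen α →
        ∀ a : (Fin n → ℕ) → (Fin n → ℝ) → ℝ,
          ((∀ β, ContDiffOn ℝ (⊤ : ℕ∞) (a β) U) ∧
            (∀ f : (Fin n → ℝ) → ℝ, ContDiff ℝ (⊤ : ℕ∞) f → ∀ x ∈ U,
              vfPow X α f x =
                ∑ β ∈ (mIdx n (mlen α + 1)).filter
                    (fun β => 1 ≤ mlen β ∧ mlen β ≤ mlen α),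
                  a β x * pdPow β f x)) →
          ((∀ β ∈ (mIdx n (mlen α + 1)).filter
              (fun β => 1 ≤ mlen β ∧ mlen β ≤ mlen α),
              WeightGe w (a β) ((wlen w β : ℤ) - (wlen w α : ℤ))) ∧
            ∃ β ∈ (mIdx n (mlen α + 1)).filter
              (fun β => 1 ≤ mlen β ∧ mlen β ≤ mlen α),
              WeightEq w (a β) ((wlen w β : ℤ) - (wlen w α : ℤ))) ] := by
  have hXs := hX.smooth
  have hcoord : ∀ k, ContDiffOn ℝ (⊤ : ℕ∞) (fun x : Fin n → ℝ => x k) U :=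
    fun k => (contDiff_coord k).contDiffOn
  have hiff : ∀ j, VFWeightEq w (X j) (-(w j : ℤ)) ↔
      ∀ k, OrdGe w (stdFrame n) (fun x => X j x k) (-(w j : ℤ) + w k) :=
    fun j => vfWeightEq_iff hU h0 (hXs j) (hX0 j)
  tfae_have 1 → 3 := by
    intro h j
    have hc : ∀ k, OrdGe w X (fun x => x k) (w k) := fun k => orderGe_iff.1 (h k).1
    refine (hiff j).2 fun k => ?_
    have := (hc k).vf_self j
    rw [vf_coord] at this
    exact (this.weight_of_order hU h0 hXs hX0 hc (contDiffOn_component (hXs j) k)).mono (by omega)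
  tfae_have 3 → 1 := by
    intro h k
    have hW := fun j => (hiff j).1 (h j)
    refine ⟨fun I hI => ?_, [k], by simp [seqW], ?_⟩
    · exact ((ordGe_coord w k).vfSeq_of_weight hU h0 hXs (hcoord k) hW I).apply_zero (by omega)
    · simp [vfSeq, vf_coord, hX0]
  tfae_have 3 → 2 := by
    intro h j
    refine ⟨vfPart w (X j) (-(w j : ℤ)), vfPart_contDiff _ _, vfPart_homog _ _, ?_⟩
    simpa using bigOCVF_of_weight hw.pos hU h0 (hXs j) ((hiff j).1 (h j))
  tfae_have 2 → 3 := by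
    intro h j
    obtain ⟨Y, hY, -, hO⟩ := h j
    exact (hiff j).2 (weight_of_bigOCVF hU h0 (hXs j) hY (by simpa using hO))
  tfae_have 3 → 4 := by
    intro h α hα a ⟨ha, hrep⟩
    have hW := fun j => (hiff j).1 (h j)
    have hge := fun β hβ =>
      (weightGe_iff hU h0 (ha β)).2 (ordGe_coeff hU h0 hXs hW ha hrep (γ := β) hβ)
    have hmem : α ∈ (mIdx n (mlen α + 1)).filter
        (fun β => 1 ≤ mlen β ∧ mlen β ≤ mlen α) := by
      refine Finset.mem_filter.2 ⟨mem_mIdx.2 fun i => ?_, hα, le_rfl⟩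
      have := le_wlen (w := fun _ => 1) (fun _ => one_pos) α i
      rw [wlen_one] at this
      omega
    refine ⟨hge, α, hmem, hge α hmem, 0, by simp [wlen], ?_⟩
    have : multiList (0 : Fin n → ℕ) = [] := by simp [multiList]
    simpa [pdPow, vfPow, this, vfSeq] using coeff_self_ne_zero hU h0 hXs hX0 hrep
  tfae_have 4 → 3 := by
    intro h j
    have hsingle : Function.Injective fun k : Fin n => (Pi.single k 1 : Fin n → ℕ) :=
      fun k l hkl => by
        by_contra hne
        have := congrFun hkl k
        simp [hne] at this
    have hlen : ∀ k : Fin n, mlen (Pi.single k 1) = 1 := fun k => by simp [mlen]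
    have hmem : ∀ k : Fin n, (Pi.single k 1 : Fin n → ℕ) ∈
        (mIdx n (mlen (Pi.single j 1 : Fin n → ℕ) + 1)).filter
          (fun β => 1 ≤ mlen β ∧ mlen β ≤ mlen (Pi.single j 1 : Fin n → ℕ)) := fun k => by
      simp only [Finset.mem_filter, mem_mIdx, hlen, le_refl, and_true]
      intro i
      by_cases hik : i = k
      · simp [hik]
      · simp [hik]
    set a : (Fin n → ℕ) → (Fin n → ℝ) → ℝ :=
      fun β x => ∑ k, if β = Pi.single k 1 then X j x k else 0 with ha
    have has : ∀ β, ContDiffOn ℝ (⊤ : ℕ∞) (a β) U := fun β => by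
      refine ContDiffOn.sum fun k _ => ?_
      split_ifs
      · exact contDiffOn_component (hXs j) k
      · exact contDiffOn_const
    obtain ⟨hge, -⟩ := h (Pi.single j 1) (hlen j).ge a ⟨has, fun f _ x _ => by
      rw [vfPow, multiList_single, vfSeq, vfSeq, vf_eq_sum, Finset.sum_apply]
      simp only [ha, Finset.sum_mul]
      rw [Finset.sum_comm]
      refine Finset.sum_congr rfl fun k _ => ?_
      rw [Finset.sum_eq_single_of_mem _ (hmem k) fun β _ hβ => by simp [hβ]]
      simp [pdPow_eq_vfSeq, multiList_single, vfSeq]⟩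
    refine (hiff j).2 fun k => (weightGe_iff hU h0 (contDiffOn_component (hXs j) k)).1 ?_
    have := hge _ (hmem k)
    simp only [ha, hsingle.eq_iff, Finset.sum_ite_eq, Finset.mem_univ, if_true, wlen_single]
      at this
    rwa [neg_add_eq_sub]
  tfae_finish

end Carnot
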